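/- Let (Ω, F, P) be a probability space and H a real normed space. Let u : [0,∞) × Ω → H and let (τ_n)_{n∈ℕ} be a sequence of measurable maps τ_n : Ω → [0,∞]. Let V : H → ℝ be Borel measurable with V ≥ 0, and for n ∈ ℕ set q_n := inf{V(x) : x ∈ H, ‖x‖ ≥ n}. Assume: (i) for every t ≥ 0 and n, the map ω ↦ u(t ∧ τ_n(ω), ω) is strongly measurable and ω ↦ V(u(t ∧ τ_n(ω), ω)) is integrable, and s ↦ E[V(u(s ∧ τ_n))] is Borel measurable; (ii) there is a constant C ≥ 0 such that for all n and all t ≥ 0, E[V(u(t ∧ τ_n))] ≤ E[V(u(0))] + C·∫₀ᵗ (1 + E[V(u(s ∧ τ_n))]) ds; (iii) E[V(u(0))] < ∞; (iv) for every n and t ≥ 0, for P-almost every ω with τ_n(ω) < t one has ‖u(t ∧ τ_n(ω), ω)‖ ≥ n. Then for every n ∈ ℕ and t ≥ 0: q_n · P({ω : τ_n(ω) < t}) ≤ (1 + E[V(u(0))])·e^{Ct} − 1. -/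

import Mathlib

open MeasureTheory
open scoped ENNReal

/-- **Gronwall's inequality** in integral form, for a function that is merely integrable. -/
theorem le_mul_exp_of_le_add_mul_integral {g : ℝ → ℝ} {A C t : ℝ} (hC : 0 ≤ C) (ht : 0 ≤ t)
    (hg : IntervalIntegrable g volume 0 t)
    (hle : ∀ s ∈ Set.Icc 0 t, g s ≤ A + C * ∫ r in (0 : ℝ)..s, g r) :
    g t ≤ A * Real.exp (C * t) := by
  have hind : Integrable ((Set.Ioc 0 t).indicator g) :=
    (integrable_indicator_iff measurableSet_Ioc).2
      ((intervalIntegrable_iff_integrableOn_Ioc_of_le ht).1 hg)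
  have hint_eq : ∀ s ∈ Set.Icc 0 t,
      ∫ r in (0 : ℝ)..s, (Set.Ioc 0 t).indicator g r = ∫ r in (0 : ℝ)..s, g r := by
    intro s hs
    refine intervalIntegral.integral_congr_ae (.of_forall fun r hr => ?_)
    rw [Set.uIoc_of_le hs.1] at hr
    exact Set.indicator_of_mem (Set.Ioc_subset_Ioc_right hs.2 hr) g
  -- The upper bound `h` is continuous, and it satisfies the same integral inequality as `g`.
  set h : ℝ → ℝ := fun s => A + C * ∫ r in (0 : ℝ)..s, (Set.Ioc 0 t).indicator g r with h_def
  have hcont : Continuous h :=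
    continuous_const.add (continuous_const.mul
      (intervalIntegral.continuous_primitive (fun _ _ => hind.intervalIntegrable) 0))
  have hgh : ∀ s ∈ Set.Icc 0 t, g s ≤ h s := fun s hs => by
    simpa only [h_def, hint_eq s hs] using hle s hs
  set k : ℝ → ℝ := fun s => A + C * ∫ r in (0 : ℝ)..s, h r with k_def
  have hhk : ∀ s ∈ Set.Icc 0 t, h s ≤ k s := by
    intro s hs
    simp only [k_def]
    rw [show h s = A + C * ∫ r in (0 : ℝ)..s, g r by simp only [h_def, hint_eq s hs]]
    have hgs : IntervalIntegrable g volume 0 s :=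
      hg.mono_set (by
        rw [Set.uIcc_of_le hs.1, Set.uIcc_of_le ht]
        exact Set.Icc_subset_Icc_right hs.2)
    gcongr
    exact intervalIntegral.integral_mono_on hs.1 hgs (hcont.intervalIntegrable 0 s)
      fun r hr => hgh r ⟨hr.1, hr.2.trans hs.2⟩
  have hderiv : ∀ s, HasDerivAt k (C * h s) s := fun s =>
    ((intervalIntegral.integral_hasDerivAt_right (hcont.intervalIntegrable 0 s)
      (hcont.stronglyMeasurableAtFilter _ _) hcont.continuousAt).const_mul C).const_add A
  have hk : k t ≤ gronwallBound A C 0 (t - 0) :=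
    le_gronwallBound_of_liminf_deriv_right_le (f' := fun s => C * h s)
      (fun s _ => (hderiv s).continuousAt.continuousWithinAt)
      (fun s _ _ hr => (hderiv s).hasDerivWithinAt.liminf_right_slope_le hr)
      (by simp [k_def])
      (fun s hs => by
        rw [add_zero]
        exact mul_le_mul_of_nonneg_left (hhk s ⟨hs.1, hs.2.le⟩) hC)
      t ⟨ht, le_rfl⟩
  rw [gronwallBound_ε0, sub_zero] at hk
  have htt : t ∈ Set.Icc 0 t := ⟨ht, le_rfl⟩
  exact (hgh t htt).trans ((hhk t htt).trans hk)

/-- The key quantitative tail estimate in the Khasminskii nonexplosion test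
(Lemma 4.4 of the paper): under a Gronwall-type bound for the Lyapunov function `V`
along the stopped process, `q_n · P(τ_n < t) ≤ (1 + E[V(u(0))]) e^{Ct} - 1`, where
`q_n = inf { V x : ‖x‖ ≥ n }`. -/
theorem khasminskii_tail_estimate
    {Ω : Type*} [MeasurableSpace Ω] (P : Measure Ω) [IsProbabilityMeasure P]
    {H : Type*} [NormedAddCommGroup H] [MeasurableSpace H] [BorelSpace H]
    (u : ℝ → Ω → H) (τ : ℕ → Ω → ℝ≥0∞) (hτ : ∀ n, Measurable (τ n))
    (V : H → ℝ) (hVmeas : Measurable V) (hVnonneg : ∀ x : H, 0 ≤ V x)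
    (C : ℝ) (hC : 0 ≤ C)
    (hmeas : ∀ (n : ℕ) (t : ℝ), 0 ≤ t →
      AEStronglyMeasurable (fun ω => u ((min (ENNReal.ofReal t) (τ n ω)).toReal) ω) P)
    (hint : ∀ (n : ℕ) (t : ℝ), 0 ≤ t →
      Integrable (fun ω => V (u ((min (ENNReal.ofReal t) (τ n ω)).toReal) ω)) P)
    (hmeas' : ∀ n : ℕ, Measurable fun s : ℝ =>
      ∫ ω, V (u ((min (ENNReal.ofReal s) (τ n ω)).toReal) ω) ∂P)
    (hgronwall : ∀ (n : ℕ) (t : ℝ), 0 ≤ t →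
      (∫ ω, V (u ((min (ENNReal.ofReal t) (τ n ω)).toReal) ω) ∂P) ≤
        (∫ ω, V (u 0 ω) ∂P) +
          C * ∫ s in (0 : ℝ)..t,
            (1 + ∫ ω, V (u ((min (ENNReal.ofReal s) (τ n ω)).toReal) ω) ∂P))
    (hint0 : Integrable (fun ω => V (u 0 ω)) P)
    (hexit : ∀ (n : ℕ) (t : ℝ), 0 ≤ t →
      ∀ᵐ ω ∂P, τ n ω < ENNReal.ofReal t →
        (n : ℝ) ≤ ‖u ((min (ENNReal.ofReal t) (τ n ω)).toReal) ω‖) :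
    ∀ (n : ℕ) (t : ℝ), 0 ≤ t →
      sInf (V '' {x : H | (n : ℝ) ≤ ‖x‖}) * (P {ω | τ n ω < ENNReal.ofReal t}).toReal ≤
        (1 + ∫ ω, V (u 0 ω) ∂P) * Real.exp (C * t) - 1 := by
  intro n t ht
  set φ : ℝ → ℝ := fun s => ∫ ω, V (u ((min (ENNReal.ofReal s) (τ n ω)).toReal) ω) ∂P with φ_def
  have h_init : 0 ≤ ∫ ω, V (u 0 ω) ∂P := integral_nonneg fun ω => hVnonneg _
  have h_growth : 1 + φ t ≤ (1 + ∫ ω, V (u 0 ω) ∂P) * Real.exp (C * t) := by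
    by_cases hi : IntervalIntegrable (fun s => 1 + φ s) volume 0 t
    · refine le_mul_exp_of_le_add_mul_integral (g := fun s => 1 + φ s) hC ht hi fun s hs => ?_
      have := hgronwall n s hs.1
      simp only [φ_def]
      linarith
    -- If `φ` is not integrable on `[0, t]`, the integral in the hypothesis is `0` by convention.
    · have h := hgronwall n t ht
      rw [intervalIntegral.integral_undef hi, mul_zero, add_zero] at h
      calc 1 + φ t ≤ 1 + ∫ ω, V (u 0 ω) ∂P := by gcongr
        _ ≤ (1 + ∫ ω, V (u 0 ω) ∂P) * Real.exp (C * t) :=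
          le_mul_of_one_le_right (by linarith) (Real.one_le_exp (mul_nonneg hC ht))
  set q : ℝ := sInf (V '' {x : H | (n : ℝ) ≤ ‖x‖})
  have hbdd : BddBelow (V '' {x : H | (n : ℝ) ≤ ‖x‖}) :=
    ⟨0, by rintro _ ⟨x, -, rfl⟩; exact hVnonneg x⟩
  have hA : MeasurableSet {ω | τ n ω < ENNReal.ofReal t} :=
    measurableSet_lt (hτ n) measurable_const
  have h_markov : q * (P {ω | τ n ω < ENNReal.ofReal t}).toReal ≤ φ t :=
    calc q * (P {ω | τ n ω < ENNReal.ofReal t}).toReal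
        = ∫ _ω in {ω | τ n ω < ENNReal.ofReal t}, q ∂P := by
          rw [setIntegral_const, smul_eq_mul, mul_comm, measureReal_def]
      _ ≤ ∫ ω in {ω | τ n ω < ENNReal.ofReal t},
            V (u ((min (ENNReal.ofReal t) (τ n ω)).toReal) ω) ∂P := by
          refine setIntegral_mono_on_ae (integrable_const q).integrableOn
            (hint n t ht).integrableOn hA ?_
          filter_upwards [hexit n t ht] with ω hω hlt
          exact csInf_le hbdd ⟨_, hω hlt, rfl⟩
      _ ≤ φ t := setIntegral_le_integral (hint n t ht) (.of_forall fun ω => hVnonneg _)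
  linarith
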